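/- arXiv:2411.16743 — 11 statements merged into one kernel-verified Lean document; each statement's English description precedes it below -/
import Mathlib

section
/- Let φ : E → ℝ be a convex function that is continuous at y, let z ∈ Q, and suppose y ∈ Q minimizes the map x ↦ φ(x) + V(x,z) over Q. Then for every x ∈ Q, φ(x) + V(x,z) ≥ φ(y) + V(y,z) + V(x,y). -/
open RealInnerProductSpace

/-- A real function with growth at least `c * t` to the right of `a` has derivative at least `c`. -/
lemma HasDerivAt.le_of_forall_mul_le_sub {f : ℝ → ℝ} {f' a c : ℝ} (hf : HasDerivAt f f' a)
    (h : ∀ t, 0 < t → t < 1 → t * c ≤ f (a + t) - f a) : c ≤ f' := by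
  refine ge_of_tendsto hf.tendsto_slope_zero_right ?_
  filter_upwards [Ioo_mem_nhdsGT (zero_lt_one' ℝ)] with t ht
  rw [smul_eq_mul, ← div_eq_inv_mul, le_div_iff₀ ht.1, mul_comm]
  exact h t ht.1 ht.2

/-- Lemma 3.2 (three-point lemma for Bregman divergence): if `y` minimizes
`x ↦ φ x + V x z` over `Q`, then `φ x + V x z ≥ φ y + V y z + V x y` for all `x ∈ Q`. -/
theorem stmt_0
    {E : Type*} [NormedAddCommGroup E] [InnerProductSpace ℝ E] [CompleteSpace E]
    (Q : Set E) (hQne : Q.Nonempty) (hQclosed : IsClosed Q) (hQconv : Convex ℝ Q)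
    (d : E → ℝ) (hd : Differentiable ℝ d) (hdconv : ConvexOn ℝ Set.univ d)
    (V : E → E → ℝ)
    (hV : ∀ x y, V x y = d x - d y - ⟪gradient d y, x - y⟫)
    (φ : E → ℝ) (hφ : ConvexOn ℝ Set.univ φ)
    (y : E) (hyQ : y ∈ Q) (hφcont : ContinuousAt φ y)
    (z : E) (hzQ : z ∈ Q)
    (hmin : ∀ x ∈ Q, φ y + V y z ≤ φ x + V x z) :
    ∀ x ∈ Q, φ y + V y z + V x y ≤ φ x + V x z := by
  intro x hx
  have hderiv : HasDerivAt (fun t : ℝ => d (y + t • (x - y))) ⟪gradient d y, x - y⟫ 0 := by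
    have hline : HasDerivAt (fun t : ℝ => y + t • (x - y)) (x - y) 0 := by
      simpa using ((hasDerivAt_id (0 : ℝ)).smul_const (x - y)).const_add y
    have hgrad := (hd (y + (0 : ℝ) • (x - y))).hasGradientAt.hasFDerivAt.comp_hasDerivAt 0 hline
    simpa [Function.comp_def] using hgrad
  have key : φ y - φ x + ⟪gradient d z, x - y⟫ ≤ ⟪gradient d y, x - y⟫ := by
    refine hderiv.le_of_forall_mul_le_sub fun t ht0 ht1 => ?_
    have hp : y + t • (x - y) = (1 - t) • y + t • x := by module
    have hpQ : y + t • (x - y) ∈ Q := by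
      rw [hp]
      exact hQconv hyQ hx (by linarith) ht0.le (by ring)
    have hφp : φ (y + t • (x - y)) ≤ (1 - t) * φ y + t * φ x := by
      rw [hp]
      exact hφ.2 (Set.mem_univ y) (Set.mem_univ x) (by linarith) ht0.le (by ring)
    have hle := hmin _ hpQ
    have hsplit : y + t • (x - y) - z = (y - z) + t • (x - y) := by abel
    rw [hV, hV, hsplit, inner_add_right, inner_smul_right] at hle
    simp only [zero_add, zero_smul, add_zero]
    linarith
  have hxz : x - z = (x - y) + (y - z) := by abel
  rw [hV y z, hV x y, hV x z, hxz, inner_add_right]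
  linarith
end

section
/- Let L > 0 and let (α_k)_{k≥0}, (A_k)_{k≥0}, (L_k)_{k≥1} be real sequences such that α_0 = 0, A_k = Σ_{i=0}^{k} α_i for all k ≥ 0, α_k > 0 and A_k = L_k · α_k² for all k ≥ 1, and 0 < L_k ≤ 2L for all k ≥ 1. Then A_k ≥ (k+1)² / (8L) for every k ≥ 1. -/
/-- If `s² / (8L) ≤ A` and `A + a ≤ 2La²`, then adding `a` to `A` advances `s` by one. -/
theorem add_one_sq_div_le_add {L A a s : ℝ} (hL : 0 < L) (ha : 0 < a) (hs : 0 ≤ s)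
    (hA : s ^ 2 / (8 * L) ≤ A) (h : A + a ≤ 2 * L * a ^ 2) :
    (s + 1) ^ 2 / (8 * L) ≤ A + a := by
  rw [div_le_iff₀ (by positivity)] at hA ⊢
  have hLa : 0 < L * a := mul_pos hL ha
  have hquad : s ^ 2 + 1 ≤ (4 * (L * a) - 1) ^ 2 := by
    nlinarith [mul_le_mul_of_nonneg_right h hL.le]
  have hx : s + 1 ≤ 4 * (L * a) := by
    have hsq : s ^ 2 ≤ (4 * (L * a) - 1) ^ 2 := by linarith
    have h1 : 1 ≤ 4 * (L * a) := by nlinarith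
    linarith [(pow_le_pow_iff_left₀ hs (by linarith) two_ne_zero).1 hsq]
  nlinarith

/-- Lemma 3.3: growth of the coefficients `A_k` in the adaptive fast gradient method. -/
theorem stmt_1
    (L : ℝ) (hL : 0 < L)
    (α A Lk : ℕ → ℝ)
    (hα0 : α 0 = 0)
    (hA : ∀ k : ℕ, A k = ∑ i ∈ Finset.range (k + 1), α i)
    (hαpos : ∀ k : ℕ, 1 ≤ k → 0 < α k)
    (hALk : ∀ k : ℕ, 1 ≤ k → A k = Lk k * (α k) ^ 2)
    (hLkpos : ∀ k : ℕ, 1 ≤ k → 0 < Lk k)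
    (hLkle : ∀ k : ℕ, 1 ≤ k → Lk k ≤ 2 * L) :
    ∀ k : ℕ, 1 ≤ k → A k ≥ ((k : ℝ) + 1) ^ 2 / (8 * L) := by
  intro k hk
  have hle : ∀ n : ℕ, 1 ≤ n → A n ≤ 2 * L * α n ^ 2 := fun n hn =>
    (hALk n hn).trans_le (mul_le_mul_of_nonneg_right (hLkle n hn) (sq_nonneg _))
  have hsucc : ∀ n : ℕ, A (n + 1) = A n + α (n + 1) := fun n => by
    rw [hA, hA, Finset.sum_range_succ]
  induction k, hk using Nat.le_induction with
  | base =>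
    have hA1 : A 1 = α 1 := by rw [hsucc, hA]; simp [hα0]
    have hpos := hαpos 1 le_rfl
    have h := hle 1 le_rfl
    rw [hA1] at h ⊢
    have h1 : 1 ≤ 2 * L * α 1 := le_of_mul_le_mul_right (by linarith) hpos
    rw [ge_iff_le, div_le_iff₀ (by positivity)]
    norm_num
    linarith
  | succ n hn ih =>
    have h := hle (n + 1) (by omega)
    rw [hsucc] at h ⊢
    push_cast
    exact add_one_sq_div_le_add hL (hαpos (n + 1) (by omega)) (by positivity) ih h
end

section
/- Fix δ ≥ 0, L' > 0, A ≥ 0, α > 0 with A' := A + α satisfying A' = L'·α². Let f : Q → ℝ be a function, x_k, u_k ∈ Q, set y := (α·u_k + A·x_k)/A' ∈ Q, and let fy ∈ ℝ and g ∈ E satisfy: (i) fy + ⟨g, x − y⟩ ≤ f(x) for all x ∈ Q. Let u' ∈ Q minimize x ↦ α·⟨g, x − y⟩ + V(x, u_k) over Q, set x' := (α·u' + A·x_k)/A' ∈ Q, and assume: (ii) there is fx' ∈ ℝ with f(x') ≤ fx' + δ and fx' ≤ fy + ⟨g, x' − y⟩ + L'·V(x', y) + δ (the line-search inequality); (iii)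 V satisfies the triangular scaling property with factor γ = 2. Then for every x ∈ Q: A'·f(x') − A·f(x_k) + V(x, u') − V(x, u_k) ≤ α·f(x) + 2δ·A'. -/
open RealInnerProductSpace

/-- First-order optimality condition for minimizing `x ↦ ⟪a, x⟫ + d x` over a convex set. -/
theorem inner_add_gradient_nonneg_of_isMinOn
    {E : Type*} [NormedAddCommGroup E] [InnerProductSpace ℝ E] [CompleteSpace E]
    {Q : Set E} (hQ : Convex ℝ Q) {d : E → ℝ} {a u x : E} (hd : DifferentiableAt ℝ d u)
    (hu : u ∈ Q) (hx : x ∈ Q) (hmin : IsMinOn (fun z => ⟪a, z⟫ + d z) Q u) :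
    0 ≤ ⟪a, x - u⟫ + ⟪gradient d u, x - u⟫ := by
  have h := hmin.localize.hasFDerivWithinAt_nonneg
    (((innerSL ℝ a).hasFDerivAt.add hd.hasGradientAt.hasFDerivAt).hasFDerivWithinAt)
    (sub_mem_posTangentConeAt_of_segment_subset (hQ.segment_subset hu hx))
  simpa using h

/-- Lemma 3.4 (one-step estimate of the adaptive fast gradient method with inexact oracle):
`A'·f(x') − A·f(x_k) + V(x, u') − V(x, u_k) ≤ α·f(x) + 2δ·A'` for all `x ∈ Q`. -/
theorem stmt_2
    {E : Type*} [NormedAddCommGroup E] [InnerProductSpace ℝ E] [CompleteSpace E]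
    (Q : Set E) (hQne : Q.Nonempty) (hQclosed : IsClosed Q) (hQconv : Convex ℝ Q)
    (d : E → ℝ) (hd : Differentiable ℝ d) (hdconv : ConvexOn ℝ Set.univ d)
    (V : E → E → ℝ)
    (hV : ∀ x y, V x y = d x - d y - ⟪gradient d y, x - y⟫)
    (δ L' A α A' : ℝ) (hδ : 0 ≤ δ) (hL' : 0 < L') (hA : 0 ≤ A) (hα : 0 < α)
    (hA' : A' = A + α) (hA'L : A' = L' * α ^ 2)
    (f : E → ℝ) (xk uk : E) (hxk : xk ∈ Q) (huk : uk ∈ Q)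
    (y : E) (hy : y = A'⁻¹ • (α • uk + A • xk)) (hyQ : y ∈ Q)
    (fy : ℝ) (g : E)
    (horacle : ∀ x ∈ Q, fy + ⟪g, x - y⟫ ≤ f x)
    (u' : E) (hu'Q : u' ∈ Q)
    (hu'min : ∀ x ∈ Q,
      α * ⟪g, u' - y⟫ + V u' uk ≤ α * ⟪g, x - y⟫ + V x uk)
    (x' : E) (hx' : x' = A'⁻¹ • (α • u' + A • xk)) (hx'Q : x' ∈ Q)
    (fx' : ℝ)
    (hfx'1 : f x' ≤ fx' + δ)
    (hfx'2 : fx' ≤ fy + ⟪g, x' - y⟫ + L' * V x' y + δ)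
    (hTSP : ∀ x ∈ Q, ∀ z ∈ Q, ∀ z' ∈ Q, ∀ θ : ℝ, θ ∈ Set.Icc (0 : ℝ) 1 →
      V ((1 - θ) • x + θ • z) ((1 - θ) • x + θ • z') ≤ θ ^ (2 : ℝ) * V z z') :
    ∀ x ∈ Q, A' * f x' - A * f xk + V x u' - V x uk ≤ α * f x + 2 * δ * A' := by
  intro x hx
  have hA'pos : 0 < A' := by linarith
  have hopt : 0 ≤ ⟪α • g - gradient d uk, x - u'⟫ + ⟪gradient d u', x - u'⟫ := by
    refine inner_add_gradient_nonneg_of_isMinOn hQconv (hd u') hu'Q hx fun z hz => ?_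
    have h := hu'min z hz
    simp only [hV, inner_sub_right] at h
    simp only [Set.mem_ofPred_eq, inner_sub_left, real_inner_smul_left]
    linarith
  have hcomb (u : E) :
      A'⁻¹ • (α • u + A • xk) = (1 - α / A') • xk + (α / A') • u := by
    have h : 1 - α / A' = A'⁻¹ * A := by
      field_simp
      linarith
    rw [h, smul_add, smul_smul, smul_smul, div_eq_inv_mul, add_comm]
  have hscale : A' * (L' * V x' y) ≤ V u' uk := by
    have h := hTSP xk hxk u' hu'Q uk huk (α / A')
      ⟨by positivity, (div_le_one hA'pos).2 (by linarith)⟩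
    rw [← hcomb, ← hcomb, ← hx', ← hy, Real.rpow_two] at h
    have hone : A' * L' * (α / A') ^ 2 = 1 := by
      field_simp
      linarith
    calc A' * (L' * V x' y) = A' * L' * V x' y := by ring
      _ ≤ A' * L' * ((α / A') ^ 2 * V u' uk) := by gcongr
      _ = V u' uk := by rw [← mul_assoc, hone, one_mul]
  have hinner : A' * ⟪g, x' - y⟫ = α * ⟪g, u' - y⟫ + A * ⟪g, xk - y⟫ := by
    have h : A' * ⟪g, x'⟫ = α * ⟪g, u'⟫ + A * ⟪g, xk⟫ := by
      rw [hx', real_inner_smul_right, inner_add_right, real_inner_smul_right,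
        real_inner_smul_right, mul_inv_cancel_left₀ hA'pos.ne']
    simp only [inner_sub_right]
    linear_combination h - ⟪g, y⟫ * hA'
  have hfx' : A' * f x' ≤ A' * (fy + ⟪g, x' - y⟫ + L' * V x' y + δ + δ) := by
    gcongr
    linarith
  have hfxk := mul_le_mul_of_nonneg_left (horacle xk hxk) hA
  have hfx := mul_le_mul_of_nonneg_left (horacle x hx) hα.le
  have hfy : A' * fy = A * fy + α * fy := by rw [hA', add_mul]
  have hthree : α * ⟪g, u' - y⟫ + V u' uk + V x u' ≤ α * ⟪g, x - y⟫ + V x uk := by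
    simp only [hV, inner_sub_left, inner_sub_right, real_inner_smul_left] at hopt ⊢
    linarith
  linarith
end

section
/- Let f : Q → ℝ, let L > 0, let N ≥ 1, and let V satisfy the triangular scaling property with factor γ = 2. Let x* ∈ Q minimize f over Q and let R > 0 satisfy V(x*, x_0) ≤ R². Suppose sequences (x_k)_{0≤k≤N}, (y_k)_{1≤k≤N}, (u_k)_{0≤k≤N} in Q, real sequences (α_k)_{0≤k≤N}, (A_k)_{0≤k≤N}, (L_k)_{1≤k≤N}, (δ_k)_{0≤k≤N−1} with δ_k ≥ 0, and for each 0 ≤ k ≤ N−1 numbers f_k(y_{k+1}), f_k(x_{k+1}) ∈ ℝ and vectors g_k ∈ E, satisfy: u_0 = x_0, α_0 = A_0 = 0; for every 0 ≤ k ≤ N−1: 0 < L_{k+1} ≤ 2L, α_{k+1} > 0, A_{k+1} = A_k + α_{k+1} = L_{k+1}·α_{k+1}², y_{k+1} = (α_{k+1}·u_k + A_k·x_k)/A_{k+1}, u_{k+1} minimizes x ↦ α_{k+1}·⟨g_k, x − y_{k+1}⟩ + V(x, u_k) over Q, x_{k+1} = (α_{k+1}·u_{k+1} + A_k·x_k)/A_{k+1};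 the oracle lower bound f_k(y_{k+1}) + ⟨g_k, x − y_{k+1}⟩ ≤ f(x) for all x ∈ Q; f(x_{k+1}) ≤ f_k(x_{k+1}) + δ_k; and the line-search inequality f_k(x_{k+1}) ≤ f_k(y_{k+1}) + ⟨g_k, x_{k+1} − y_{k+1}⟩ + L_{k+1}·V(x_{k+1}, y_{k+1}) + δ_k. Then f(x_N) − f(x*) ≤ 8·L·R²/(N+1)² + (2/A_N)·Σ_{k=0}^{N−1} A_{k+1}·δ_k. -/
open RealInnerProductSpace

/-- A function on the line that is minimized over `[0, 1]` at `0` has nonnegative derivative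
there. -/
lemma nonneg_of_hasDerivAt_of_le {φ : ℝ → ℝ} {c : ℝ} (h : HasDerivAt φ c 0)
    (hmin : ∀ t ∈ Set.Icc (0 : ℝ) 1, φ 0 ≤ φ t) : 0 ≤ c := by
  have hslope := (hasDerivWithinAt_iff_tendsto_slope' (s := Set.Ioi (0 : ℝ)) (by simp)).1
    (h.hasDerivWithinAt (s := Set.Ioi 0))
  refine ge_of_tendsto hslope ?_
  filter_upwards [Ioo_mem_nhdsGT (zero_lt_one' ℝ)] with t ht
  rw [slope_def_field]
  exact div_nonneg (sub_nonneg.2 (hmin t ⟨ht.1.le, ht.2.le⟩)) (by linarith [ht.1])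

section Bregman

variable {E : Type*} [NormedAddCommGroup E] [InnerProductSpace ℝ E] [CompleteSpace E]

lemma hasDerivAt_comp_line {d : E → ℝ} (hd : Differentiable ℝ d) (y v : E) :
    HasDerivAt (fun t : ℝ => d (y + t • v)) ⟪gradient d y, v⟫ 0 := by
  have h1 : HasDerivAt (fun t : ℝ => y + t • v) v 0 := by
    simpa using ((hasDerivAt_id (0 : ℝ)).smul_const v).const_add y
  have h2 : HasFDerivAt d (InnerProductSpace.toDual ℝ E (gradient d y)) (y + (0 : ℝ) • v) := by
    simpa using (hd y).hasGradientAt.hasFDerivAt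
  exact h2.comp_hasDerivAt (0 : ℝ) h1

/-- The Bregman divergence of a differentiable convex function is nonnegative. -/
lemma bregman_nonneg {d : E → ℝ} (hd : Differentiable ℝ d) (hdconv : ConvexOn ℝ Set.univ d)
    (x y : E) : 0 ≤ d x - d y - ⟪gradient d y, x - y⟫ := by
  refine nonneg_of_hasDerivAt_of_le (φ := fun t : ℝ => t * (d x - d y) - d (y + t • (x - y)))
    ?_ fun t ht => ?_
  · exact (hasDerivAt_mul_const (d x - d y)).fun_sub
      (hasDerivAt_comp_line hd y (x - y))
  · have h := hdconv.2 (Set.mem_univ y) (Set.mem_univ x) (sub_nonneg.2 ht.2) ht.1 (by ring)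
    have e : (1 - t) • y + t • x = y + t • (x - y) := by module
    rw [e] at h
    simp only [smul_eq_mul] at h
    simp only [zero_mul, zero_smul, add_zero]
    linarith

/-- Three-point inequality for a Bregman proximal step, with `u'` the minimizer of
`x ↦ a * ⟪g, x - y⟫ + V x u` over `Q`. -/
lemma bregman_prox_le {d : E → ℝ} (hd : Differentiable ℝ d) {V : E → E → ℝ}
    (hV : ∀ x y, V x y = d x - d y - ⟪gradient d y, x - y⟫) {Q : Set E} (hQ : Convex ℝ Q)
    {a : ℝ} {g y u u' : E} (hu' : u' ∈ Q)
    (hmin : ∀ x ∈ Q, a * ⟪g, u' - y⟫ + V u' u ≤ a * ⟪g, x - y⟫ + V x u)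
    {x : E} (hx : x ∈ Q) :
    a * ⟪g, u' - y⟫ + V u' u + V x u' ≤ a * ⟪g, x - y⟫ + V x u := by
  have key : 0 ≤ a * ⟪g, x - u'⟫ + (⟪gradient d u', x - u'⟫ - ⟪gradient d u, x - u'⟫) := by
    refine nonneg_of_hasDerivAt_of_le (φ := fun t : ℝ =>
      t * (a * ⟪g, x - u'⟫) + (d (u' + t • (x - u')) - t * ⟪gradient d u, x - u'⟫))
      ?_ fun t ht => ?_
    · exact (hasDerivAt_mul_const (a * ⟪g, x - u'⟫)).fun_add
        ((hasDerivAt_comp_line hd u' (x - u')).fun_sub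
          (hasDerivAt_mul_const ⟪gradient d u, x - u'⟫))
    · have h := hmin _ (hQ.add_smul_sub_mem hu' hx ht)
      rw [hV, hV, add_sub_right_comm, add_sub_right_comm u', inner_add_right, inner_add_right,
        real_inner_smul_right, real_inner_smul_right] at h
      simp only [zero_mul, zero_smul, add_zero, zero_add, sub_zero]
      linarith
  rw [hV, hV, hV]
  simp only [inner_sub_right] at key ⊢
  linarith

/-- One step of the accelerated method decreases the potential `A (f x - f x*) + V x* u`
up to the oracle error. -/
lemma accelerated_step {Q : Set E} (hQ : Convex ℝ Q) {d : E → ℝ} (hd : Differentiable ℝ d)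
    {V : E → E → ℝ} (hV : ∀ x y, V x y = d x - d y - ⟪gradient d y, x - y⟫)
    (hTSP : ∀ x ∈ Q, ∀ z ∈ Q, ∀ z' ∈ Q, ∀ θ : ℝ, θ ∈ Set.Icc (0 : ℝ) 1 →
      V ((1 - θ) • x + θ • z) ((1 - θ) • x + θ • z') ≤ θ ^ (2 : ℝ) * V z z')
    {f : E → ℝ} {p x x' y u u' g : E} {A A' a l δ fy fx : ℝ}
    (hp : p ∈ Q) (hxQ : x ∈ Q) (hu : u ∈ Q) (hu' : u' ∈ Q)
    (hA : 0 ≤ A) (ha : 0 < a) (hl : 0 < l) (hA' : A' = A + a) (hAl : A' = l * a ^ 2)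
    (hy : y = A'⁻¹ • (a • u + A • x)) (hx' : x' = A'⁻¹ • (a • u' + A • x))
    (hmin : ∀ z ∈ Q, a * ⟪g, u' - y⟫ + V u' u ≤ a * ⟪g, z - y⟫ + V z u)
    (horacle : ∀ z ∈ Q, fy + ⟪g, z - y⟫ ≤ f z) (hfx : f x' ≤ fx + δ)
    (hls : fx ≤ fy + ⟪g, x' - y⟫ + l * V x' y + δ) :
    A' * (f x' - f p) + V p u' ≤ A * (f x - f p) + V p u + 2 * (A' * δ) := by
  have hA'pos : 0 < A' := by linarith
  have hcomb (w : E) : A'⁻¹ • (a • w + A • x) = (1 - a / A') • x + (a / A') • w := by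
    have e : 1 - a / A' = A'⁻¹ * A := by field_simp; linarith
    rw [e, div_eq_inv_mul]
    module
  have hscale : A' * (l * V x' y) ≤ V u' u := by
    have h := hTSP x hxQ u' hu' u hu (a / A')
      ⟨by positivity, (div_le_one hA'pos).2 (by linarith)⟩
    rw [← hcomb, ← hcomb, ← hx', ← hy, Real.rpow_two] at h
    have e : A' * l * (a / A') ^ 2 = 1 := by
      field_simp
      linarith
    calc A' * (l * V x' y) = A' * l * V x' y := by ring
      _ ≤ A' * l * ((a / A') ^ 2 * V u' u) := by gcongr
      _ = A' * l * (a / A') ^ 2 * V u' u := by ring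
      _ = V u' u := by rw [e, one_mul]
  have hinner : A' * ⟪g, x' - y⟫ = a * ⟪g, u' - y⟫ + A * ⟪g, x - y⟫ := by
    have e : A' • (x' - y) = a • (u' - y) + A • (x - y) := by
      rw [smul_sub, hx', smul_inv_smul₀ hA'pos.ne', hA']
      module
    rw [← real_inner_smul_right, e, inner_add_right, real_inner_smul_right,
      real_inner_smul_right]
  have hprox := bregman_prox_le hd hV hQ hu' hmin hp
  have h1 : A' * f x' ≤ A' * (fy + ⟪g, x' - y⟫ + l * V x' y + δ + δ) := by
    gcongr
    linarith
  have h2 := mul_le_mul_of_nonneg_left (horacle x hxQ) hA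
  have h3 := mul_le_mul_of_nonneg_left (horacle p hp) ha.le
  have h4 : A' * fy = A * fy + a * fy := by rw [hA']; ring
  have h5 : A' * f p = A * f p + a * f p := by rw [hA']; ring
  linarith

end Bregman

/-- Quadratic growth of the step-size sum `A` in the accelerated method. -/
lemma sq_succ_le_of_step {L A A' a l : ℝ} {k : ℕ} (hL : 0 < L) (ha : 0 < a)
    (hl : l ≤ 2 * L) (hA' : A' = A + a) (hAl : A' = l * a ^ 2)
    (h : ((k : ℝ) + 1) ^ 2 ≤ 8 * L * A) : ((k : ℝ) + 2) ^ 2 ≤ 8 * L * A' := by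
  have hLA : 0 ≤ 8 * L * A' := by
    rw [hA']
    nlinarith [sq_nonneg ((k : ℝ) + 1), mul_pos hL ha]
  set s := √(8 * L * A') with hs
  have hs0 : 0 ≤ s := Real.sqrt_nonneg _
  have hsq : s ^ 2 = 8 * L * A' := Real.sq_sqrt hLA
  have hstep : 2 * s ≤ 8 * L * a := by
    refine (sq_le_sq₀ (by positivity) (by positivity)).1 ?_
    have : A' ≤ 2 * L * a ^ 2 := by rw [hAl]; gcongr
    nlinarith
  have hk : (0 : ℝ) ≤ k := k.cast_nonneg
  have hs2 : ((k : ℝ) + 1) ^ 2 + 2 * s ≤ s ^ 2 := by rw [hsq, hA']; linarith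
  rw [← hsq]
  have : (k : ℝ) + 2 ≤ s := by nlinarith
  gcongr

/-- Theorem 3.1 (convergence rate of the adaptive fast gradient method with inexact oracle):
`f(x_N) − f(x*) ≤ 8LR²/(N+1)² + (2/A_N)·Σ_{k=0}^{N−1} A_{k+1}·δ_k`. -/
theorem stmt_3
    {E : Type*} [NormedAddCommGroup E] [InnerProductSpace ℝ E] [CompleteSpace E]
    (Q : Set E) (hQne : Q.Nonempty) (hQclosed : IsClosed Q) (hQconv : Convex ℝ Q)
    (d : E → ℝ) (hd : Differentiable ℝ d) (hdconv : ConvexOn ℝ Set.univ d)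
    (V : E → E → ℝ)
    (hV : ∀ x y, V x y = d x - d y - ⟪gradient d y, x - y⟫)
    (hTSP : ∀ x ∈ Q, ∀ z ∈ Q, ∀ z' ∈ Q, ∀ θ : ℝ, θ ∈ Set.Icc (0 : ℝ) 1 →
      V ((1 - θ) • x + θ • z) ((1 - θ) • x + θ • z') ≤ θ ^ (2 : ℝ) * V z z')
    (f : E → ℝ) (L : ℝ) (hL : 0 < L) (N : ℕ) (hN : 1 ≤ N)
    (xstar : E) (hstarQ : xstar ∈ Q) (hstarmin : ∀ x ∈ Q, f xstar ≤ f x)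
    (xs ys us : ℕ → E) (α A Lk δ : ℕ → ℝ)
    (fy fx : ℕ → ℝ) (g : ℕ → E)
    (R : ℝ) (hR : 0 < R) (hVR : V xstar (xs 0) ≤ R ^ 2)
    (hmemx : ∀ k ≤ N, xs k ∈ Q)
    (hmemy : ∀ k : ℕ, 1 ≤ k → k ≤ N → ys k ∈ Q)
    (hmemu : ∀ k ≤ N, us k ∈ Q)
    (hu0 : us 0 = xs 0) (hα0 : α 0 = 0) (hA0 : A 0 = 0)
    (hδ : ∀ k < N, 0 ≤ δ k)
    (hLkpos : ∀ k < N, 0 < Lk (k + 1))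
    (hLkle : ∀ k < N, Lk (k + 1) ≤ 2 * L)
    (hαpos : ∀ k < N, 0 < α (k + 1))
    (hArec : ∀ k < N, A (k + 1) = A k + α (k + 1))
    (hALk : ∀ k < N, A (k + 1) = Lk (k + 1) * (α (k + 1)) ^ 2)
    (hy : ∀ k < N, ys (k + 1) = (A (k + 1))⁻¹ • (α (k + 1) • us k + A k • xs k))
    (humin : ∀ k < N, ∀ x ∈ Q,
      α (k + 1) * ⟪g k, us (k + 1) - ys (k + 1)⟫ + V (us (k + 1)) (us k)
        ≤ α (k + 1) * ⟪g k, x - ys (k + 1)⟫ + V x (us k))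
    (hx : ∀ k < N, xs (k + 1) = (A (k + 1))⁻¹ • (α (k + 1) • us (k + 1) + A k • xs k))
    (horacle : ∀ k < N, ∀ x ∈ Q, fy k + ⟪g k, x - ys (k + 1)⟫ ≤ f x)
    (hfx : ∀ k < N, f (xs (k + 1)) ≤ fx k + δ k)
    (hls : ∀ k < N, fx k ≤ fy k + ⟪g k, xs (k + 1) - ys (k + 1)⟫
        + Lk (k + 1) * V (xs (k + 1)) (ys (k + 1)) + δ k) :
    f (xs N) - f xstar ≤ 8 * L * R ^ 2 / ((N : ℝ) + 1) ^ 2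
      + (2 / A N) * ∑ k ∈ Finset.range N, A (k + 1) * δ k := by
  have hA_nonneg : ∀ k ≤ N, 0 ≤ A k := by
    intro k
    induction k with
    | zero => simp [hA0]
    | succ k ih => intro hk; linarith [ih (by omega), hArec k hk, hαpos k hk]
  have hpot : ∀ k ≤ N, A k * (f (xs k) - f xstar) + V xstar (us k)
      ≤ R ^ 2 + 2 * ∑ i ∈ Finset.range k, A (i + 1) * δ i := by
    intro k
    induction k with
    | zero => simpa [hA0, hu0] using hVR
    | succ k ih =>
      intro hk
      have h := accelerated_step hQconv hd hV hTSP hstarQ (hmemx k (by omega))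
        (hmemu k (by omega)) (hmemu (k + 1) hk) (hA_nonneg k (by omega)) (hαpos k hk)
        (hLkpos k hk) (hArec k hk) (hALk k hk) (hy k hk) (hx k hk) (humin k hk)
        (horacle k hk) (hfx k hk) (hls k hk)
      rw [Finset.sum_range_succ]
      linarith [ih (by omega)]
  have hgrow : ((N : ℝ) + 1) ^ 2 ≤ 8 * L * A N := by
    suffices ∀ k, 1 ≤ k → k ≤ N → ((k : ℝ) + 1) ^ 2 ≤ 8 * L * A k from this N hN le_rfl
    intro k hk
    induction k, hk using Nat.le_induction with
    | base =>
      intro h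
      have h1 : A 1 = α 1 := by simpa [hA0] using hArec 0 h
      have h2 : A 1 = Lk 1 * α 1 ^ 2 := hALk 0 h
      have h3 : 0 < α 1 := hαpos 0 h
      have h4 : Lk 1 ≤ 2 * L := hLkle 0 h
      have h5 : Lk 1 * α 1 = 1 := mul_right_cancel₀ h3.ne' (by linarith)
      have h6 : Lk 1 * α 1 ≤ 2 * L * α 1 := by gcongr
      rw [h1]
      norm_num
      linarith
    | succ k _ ih =>
      intro h
      have := sq_succ_le_of_step hL (hαpos k h) (hLkle k h) (hArec k h) (hALk k h)
        (ih (by omega))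
      convert this using 2
      push_cast
      ring
  have hApos : 0 < A N := by
    have : 0 < 8 * L * A N := lt_of_lt_of_le (by positivity) hgrow
    exact pos_of_mul_pos_right this (by positivity)
  have hVnonneg : 0 ≤ V xstar (us N) := by
    rw [hV]
    exact bregman_nonneg hd hdconv _ _
  have hfinal := hpot N le_rfl
  calc f (xs N) - f xstar
      ≤ (R ^ 2 + 2 * ∑ i ∈ Finset.range N, A (i + 1) * δ i) / A N := by
        rw [le_div_iff₀ hApos]
        linarith
    _ = R ^ 2 / A N + (2 / A N) * ∑ i ∈ Finset.range N, A (i + 1) * δ i := by ring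
    _ ≤ 8 * L * R ^ 2 / ((N : ℝ) + 1) ^ 2
        + (2 / A N) * ∑ i ∈ Finset.range N, A (i + 1) * δ i := by
        gcongr ?_ + _
        rw [div_le_div_iff₀ hApos (by positivity)]
        nlinarith [mul_le_mul_of_nonneg_left hgrow (sq_nonneg R)]
end

section
/- If the Bregman divergence V is jointly convex on Q × Q, i.e. the map (x,y) ↦ V(x,y) is convex on Q × Q, then V satisfies the triangular scaling property with factor γ = 1: for all x, z, z̃ ∈ Q and θ ∈ [0,1], V((1−θ)x + θz, (1−θ)x + θz̃) ≤ θ · V(z, z̃). -/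
open RealInnerProductSpace

/-- If the Bregman divergence `V` is jointly convex on `Q × Q`, then it satisfies the
triangular scaling property with factor `γ = 1`. -/
theorem stmt_4
    {E : Type*} [NormedAddCommGroup E] [InnerProductSpace ℝ E] [CompleteSpace E]
    (Q : Set E) (hQne : Q.Nonempty) (hQclosed : IsClosed Q) (hQconv : Convex ℝ Q)
    (d : E → ℝ) (hd : Differentiable ℝ d) (hdconv : ConvexOn ℝ Set.univ d)
    (V : E → E → ℝ)
    (hV : ∀ x y, V x y = d x - d y - ⟪gradient d y, x - y⟫)
    (hjc : ConvexOn ℝ (Q ×ˢ Q) (fun p : E × E => V p.1 p.2)) :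
    ∀ x ∈ Q, ∀ z ∈ Q, ∀ z' ∈ Q, ∀ θ : ℝ, θ ∈ Set.Icc (0 : ℝ) 1 →
      V ((1 - θ) • x + θ • z) ((1 - θ) • x + θ • z') ≤ θ * V z z' := by
  intro x hx z hz z' hz' θ hθ
  have hdiag : V x x = 0 := by simp [hV]
  have h := hjc.2 (Set.mk_mem_prod hx hx) (Set.mk_mem_prod hz hz')
    (sub_nonneg.mpr hθ.2) hθ.1 (sub_add_cancel 1 θ)
  simpa [hdiag] using h
end

section
/- For every γ ∈ (1,2], the sequence θ_k := γ/(k+γ) for k ≥ 0 satisfies θ_k ∈ (0,1] for all k ≥ 0, and (1 − θ_{k+1})/θ_{k+1}^γ ≤ 1/θ_k^γ for all k ≥ 0. -/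
/-- Lemma 4.2: for `γ ∈ (1,2]`, the sequence `θ_k = γ/(k+γ)` lies in `(0,1]` and satisfies
`(1 − θ_{k+1})/θ_{k+1}^γ ≤ 1/θ_k^γ`. -/
theorem stmt_5
    (γ : ℝ) (hγ1 : 1 < γ) (hγ2 : γ ≤ 2) :
    (∀ k : ℕ, γ / ((k : ℝ) + γ) ∈ Set.Ioc (0 : ℝ) 1) ∧
    (∀ k : ℕ,
      (1 - γ / (((k : ℝ) + 1) + γ)) / (γ / (((k : ℝ) + 1) + γ)) ^ γ
        ≤ 1 / (γ / ((k : ℝ) + γ)) ^ γ) := by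
  refine ⟨fun k => ?_, fun k => ?_⟩
  · have hk : (0 : ℝ) ≤ k := k.cast_nonneg
    exact ⟨by positivity, (div_le_one (by positivity)).2 (by linarith)⟩
  · have hk : (0 : ℝ) ≤ k := k.cast_nonneg
    have hγ : 0 < γ := by linarith
    have ha : 0 < γ / ((k : ℝ) + 1 + γ) := by positivity
    have hb : 0 < γ / ((k : ℝ) + γ) := by positivity
    have hs : -1 ≤ -(1 / ((k : ℝ) + 1 + γ)) :=
      neg_le_neg ((div_le_one (by positivity)).2 (by linarith))
    have bernoulli := one_add_mul_self_le_rpow_one_add hs hγ1.le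
    have ratio : 1 + -(1 / ((k : ℝ) + 1 + γ)) =
        (γ / ((k : ℝ) + 1 + γ)) / (γ / ((k : ℝ) + γ)) := by
      field_simp
      ring
    rw [ratio, Real.div_rpow ha.le hb.le] at bernoulli
    rw [div_le_iff₀ (Real.rpow_pos_of_pos ha γ), one_div_mul_eq_div]
    calc 1 - γ / ((k : ℝ) + 1 + γ) = 1 + γ * -(1 / ((k : ℝ) + 1 + γ)) := by ring
      _ ≤ _ := bernoulli
end

section
/- Let f : Q → ℝ, δ ≥ 0, L > 0, and suppose (f_δ, g_δ) is a (δ,L)-oracle of f on Q, and V satisfies the triangular scaling property with factor γ ∈ (1,2]. Define g(x|y) := f_δ(y) + ⟨g_δ(y), x − y⟩. Fix θ ∈ (0,1] and x_k, z_k ∈ Q; set y := (1−θ)·x_k + θ·z_k, let z' ∈ Q minimize z ↦ g(z|y) + θ^{γ−1}·L·V(z, z_k) over Q, and set x' := (1−θ)·x_k + θ·z'. Then for every x ∈ Q: (1/θ^γ)·(f(x') − f(x)) + L·V(x, z') ≤ ((1−θ)/θ^γ)·(f(x_k) − f(x)) + L·V(x, z_k) + δ/θ^γ. -/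
open RealInnerProductSpace

/-- The three-point identity of the Bregman divergence of `d`. -/
theorem bregman_three_point {E : Type*} [NormedAddCommGroup E] [InnerProductSpace ℝ E]
    [CompleteSpace E] {d : E → ℝ} {V : E → E → ℝ}
    (hV : ∀ x y, V x y = d x - d y - ⟪gradient d y, x - y⟫) (x z w : E) :
    V x w - V x z - V z w = ⟪gradient d z - gradient d w, x - z⟫ := by
  simp only [hV, inner_sub_left, inner_sub_right]
  ring

/-- First-order optimality for a Bregman proximal step: a minimizer of a linear function plus a
multiple of the Bregman divergence satisfies the three-point inequality. -/
theorem bregman_prox_inequality {E : Type*} [NormedAddCommGroup E] [InnerProductSpace ℝ E]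
    [CompleteSpace E] {Q : Set E} (hQ : Convex ℝ Q) {d : E → ℝ} {V : E → E → ℝ}
    (hV : ∀ x y, V x y = d x - d y - ⟪gradient d y, x - y⟫)
    {g w z : E} {a : ℝ} (hd : DifferentiableAt ℝ d z) (hz : z ∈ Q)
    (hmin : IsMinOn (fun u => ⟪g, u⟫ + a * V u w) Q z) {x : E} (hx : x ∈ Q) :
    ⟪g, z⟫ + a * V z w + a * V x z ≤ ⟪g, x⟫ + a * V x w := by
  have hlin (v : E) : HasFDerivAt (fun u : E => ⟪v, u⟫) (innerSL ℝ v) z :=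
    (innerSL ℝ v).hasFDerivAt
  have hder : HasFDerivAt (fun u => ⟪g, u⟫ + a * V u w)
      (innerSL ℝ g + a • (innerSL ℝ (gradient d z) - innerSL ℝ (gradient d w))) z := by
    have hdz : HasFDerivAt d (innerSL ℝ (gradient d z)) z := hd.hasGradientAt.hasFDerivAt
    have hVz : HasFDerivAt (fun u => V u w)
        (innerSL ℝ (gradient d z) - innerSL ℝ (gradient d w)) z := by
      have h := (hdz.sub (hlin (gradient d w))).add_const (⟪gradient d w, w⟫ - d w)
      refine h.congr_of_eventuallyEq (Filter.Eventually.of_forall fun u => ?_)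
      simp only [hV, inner_sub_right, Pi.sub_apply]
      ring
    exact (hlin g).add (hVz.const_mul a)
  have hnonneg := hmin.localize.hasFDerivWithinAt_nonneg hder.hasFDerivWithinAt
    (sub_mem_posTangentConeAt_of_segment_subset (hQ.segment_subset hz hx))
  have hthree := bregman_three_point hV x z w
  simp only [add_apply, smul_apply,
    sub_apply, innerSL_apply_apply, smul_eq_mul,
    ← inner_sub_left, ← hthree] at hnonneg
  rw [inner_sub_right] at hnonneg
  linarith

/-- Lemma 4.3 (one-step estimate of the non-adaptive accelerated Bregman proximal gradient
method with a `(δ,L)`-oracle). -/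
theorem stmt_6
    {E : Type*} [NormedAddCommGroup E] [InnerProductSpace ℝ E] [CompleteSpace E]
    (Q : Set E) (hQne : Q.Nonempty) (hQclosed : IsClosed Q) (hQconv : Convex ℝ Q)
    (d : E → ℝ) (hd : Differentiable ℝ d) (hdconv : ConvexOn ℝ Set.univ d)
    (V : E → E → ℝ)
    (hV : ∀ x y, V x y = d x - d y - ⟪gradient d y, x - y⟫)
    (f fδ : E → ℝ) (gδ : E → E) (δ L γ : ℝ)
    (hδ : 0 ≤ δ) (hL : 0 < L) (hγ1 : 1 < γ) (hγ2 : γ ≤ 2)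
    (horacle : ∀ x ∈ Q, ∀ y ∈ Q,
      0 ≤ f x - fδ y - ⟪gδ y, x - y⟫ ∧
      f x - fδ y - ⟪gδ y, x - y⟫ ≤ L * V x y + δ)
    (hTSP : ∀ x ∈ Q, ∀ z ∈ Q, ∀ z' ∈ Q, ∀ θ : ℝ, θ ∈ Set.Icc (0 : ℝ) 1 →
      V ((1 - θ) • x + θ • z) ((1 - θ) • x + θ • z') ≤ θ ^ γ * V z z')
    (θ : ℝ) (hθ : θ ∈ Set.Ioc (0 : ℝ) 1)
    (xk zk : E) (hxk : xk ∈ Q) (hzk : zk ∈ Q)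
    (y : E) (hy : y = (1 - θ) • xk + θ • zk)
    (z' : E) (hz'Q : z' ∈ Q)
    (hz'min : ∀ z ∈ Q,
      fδ y + ⟪gδ y, z' - y⟫ + θ ^ (γ - 1) * L * V z' zk
        ≤ fδ y + ⟪gδ y, z - y⟫ + θ ^ (γ - 1) * L * V z zk)
    (x' : E) (hx' : x' = (1 - θ) • xk + θ • z') :
    ∀ x ∈ Q,
      (1 / θ ^ γ) * (f x' - f x) + L * V x z'
        ≤ ((1 - θ) / θ ^ γ) * (f xk - f x) + L * V x zk + δ / θ ^ γ := by
  intro x hx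
  obtain ⟨hθ0, hθ1⟩ := hθ
  have hconv {u v : E} (hu : u ∈ Q) (hv : v ∈ Q) : (1 - θ) • u + θ • v ∈ Q :=
    hQconv hu hv (by linarith) hθ0.le (by ring)
  have hyQ : y ∈ Q := hy ▸ hconv hxk hzk
  have hx'Q : x' ∈ Q := hx' ▸ hconv hxk hz'Q
  have hpow : 0 < θ ^ γ := Real.rpow_pos_of_pos hθ0 γ
  have hpow_mul : θ * θ ^ (γ - 1) = θ ^ γ := by
    rw [Real.rpow_sub_one hθ0.ne']
    field_simp
  have hprox := bregman_prox_inequality hQconv hV (g := gδ y) (w := zk)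
    (a := θ ^ (γ - 1) * L) (hd z') hz'Q (fun z hz => by
      have h := hz'min z hz
      simp only [inner_sub_right] at h
      simp only [Set.mem_ofPred_eq]
      linarith) hx
  have hprox' := mul_le_mul_of_nonneg_left hprox hθ0.le
  have hscale : L * V x' y ≤ L * (θ ^ γ * V z' zk) := by
    rw [hx', hy]
    exact mul_le_mul_of_nonneg_left (hTSP xk hxk z' hz'Q zk hzk θ ⟨hθ0.le, hθ1⟩) hL.le
  have hupper := (horacle x' hx'Q y hyQ).2
  have hlower_xk := mul_nonneg (sub_nonneg.2 hθ1) (horacle xk hxk y hyQ).1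
  have hlower_x := mul_nonneg hθ0.le (horacle x hx y hyQ).1
  have hinner : ⟪gδ y, x'⟫ = (1 - θ) * ⟪gδ y, xk⟫ + θ * ⟪gδ y, z'⟫ := by
    rw [hx', inner_add_right, real_inner_smul_right, real_inner_smul_right]
  simp only [inner_sub_right] at hupper hlower_xk hlower_x
  have hmain : f x' - f x + θ ^ γ * (L * V x z')
      ≤ (1 - θ) * (f xk - f x) + θ ^ γ * (L * V x zk) + δ := by
    rw [← hpow_mul] at hscale ⊢
    linarith
  calc (1 / θ ^ γ) * (f x' - f x) + L * V x z'
      = (f x' - f x + θ ^ γ * (L * V x z')) / θ ^ γ := by field_simp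
    _ ≤ ((1 - θ) * (f xk - f x) + θ ^ γ * (L * V x zk) + δ) / θ ^ γ := by gcongr
    _ = _ := by field_simp
end

section
/- Let f : Q → ℝ, δ ≥ 0, L' > 0, γ ∈ (1,2], and suppose V satisfies the triangular scaling property with factor γ. Fix θ ∈ (0,1] and x_k, z_k ∈ Q; set y := (1−θ)·x_k + θ·z_k. Let fy ∈ ℝ and g ∈ E satisfy the oracle lower bound fy + ⟨g, x − y⟩ ≤ f(x) for all x ∈ Q, and write g(x|y) := fy + ⟨g, x − y⟩. Let z' ∈ Q minimize z ↦ g(z|y) + θ^{γ−1}·L'·V(z, z_k) over Q, set x' := (1−θ)·x_k + θ·z', and assume the line-search upper bound f(x') ≤ g(x'|y) + L'·V(x', y) + δ. Then for every x ∈ Q: (1/θ^γ)·(f(x') − f(x)) + L'·V(x, z') ≤ ((1−θ)/θ^γ)·(f(x_k) − f(x)) + L'·V(x, z_k) + δ/θ^γ. -/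
open RealInnerProductSpace

/-- First-order optimality condition for a differentiable function minimized over a convex set. -/
theorem IsMinOn.inner_gradient_nonneg
    {E : Type*} [NormedAddCommGroup E] [InnerProductSpace ℝ E] [CompleteSpace E]
    {Q : Set E} (hQ : Convex ℝ Q) {φ : E → ℝ} {v z x : E} (hmin : IsMinOn φ Q z)
    (hφ : HasGradientAt φ v z) (hz : z ∈ Q) (hx : x ∈ Q) :
    0 ≤ ⟪v, x - z⟫ := by
  have h := hmin.localize.hasFDerivWithinAt_nonneg hφ.hasFDerivAt.hasFDerivWithinAt
    (sub_mem_posTangentConeAt_of_segment_subset (hQ.segment_subset hz hx))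
  simpa using h

/-- Three-point inequality for a Bregman proximal step with a linear objective. -/
theorem bregman_prox_three_point
    {E : Type*} [NormedAddCommGroup E] [InnerProductSpace ℝ E] [CompleteSpace E]
    {Q : Set E} (hQ : Convex ℝ Q) {d : E → ℝ} {V : E → E → ℝ}
    (hV : ∀ x y, V x y = d x - d y - ⟪gradient d y, x - y⟫)
    {c : ℝ} {g w z x : E} (hd : DifferentiableAt ℝ d z) (hz : z ∈ Q) (hx : x ∈ Q)
    (hmin : ∀ u ∈ Q, ⟪g, z⟫ + c * V z w ≤ ⟪g, u⟫ + c * V u w) :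
    ⟪g, z⟫ + c * V z w + c * V x z ≤ ⟪g, x⟫ + c * V x w := by
  have hgrad : HasGradientAt (fun u => ⟪g, u⟫ + c * V u w)
      (g + c • (gradient d z - gradient d w)) z := by
    have h1 : HasFDerivAt (fun u : E => ⟪g, u⟫) (innerSL ℝ g) z := (innerSL ℝ g).hasFDerivAt
    have h2 : HasFDerivAt (fun u : E => ⟪gradient d w, u - w⟫) (innerSL ℝ (gradient d w)) z :=
      (innerSL ℝ (gradient d w)).hasFDerivAt.comp z ((hasFDerivAt_id z).sub_const w)
    have h3 := h1.add (((hd.hasGradientAt.hasFDerivAt.sub_const (d w)).sub h2).const_mul c)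
    simp only [hV]
    rw [hasGradientAt_iff_hasFDerivAt]
    refine h3.congr_fderiv ?_
    ext u
    simp
  have h := IsMinOn.inner_gradient_nonneg hQ (isMinOn_iff.2 hmin) hgrad hz hx
  simp only [hV]
  simp only [inner_add_left, inner_smul_left, inner_sub_left, inner_sub_right,
    conj_trivial] at h ⊢
  linarith

/-- Lemma 4.4 (one-step estimate of the adaptive accelerated Bregman proximal gradient method
with inexact oracle, with constant `L'` found by line search). -/
theorem stmt_8
    {E : Type*} [NormedAddCommGroup E] [InnerProductSpace ℝ E] [CompleteSpace E]
    (Q : Set E) (hQne : Q.Nonempty) (hQclosed : IsClosed Q) (hQconv : Convex ℝ Q)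
    (d : E → ℝ) (hd : Differentiable ℝ d) (hdconv : ConvexOn ℝ Set.univ d)
    (V : E → E → ℝ)
    (hV : ∀ x y, V x y = d x - d y - ⟪gradient d y, x - y⟫)
    (f : E → ℝ) (δ L' γ : ℝ)
    (hδ : 0 ≤ δ) (hL' : 0 < L') (hγ1 : 1 < γ) (hγ2 : γ ≤ 2)
    (hTSP : ∀ x ∈ Q, ∀ z ∈ Q, ∀ z' ∈ Q, ∀ θ : ℝ, θ ∈ Set.Icc (0 : ℝ) 1 →
      V ((1 - θ) • x + θ • z) ((1 - θ) • x + θ • z') ≤ θ ^ γ * V z z')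
    (θ : ℝ) (hθ : θ ∈ Set.Ioc (0 : ℝ) 1)
    (xk zk : E) (hxk : xk ∈ Q) (hzk : zk ∈ Q)
    (y : E) (hy : y = (1 - θ) • xk + θ • zk)
    (fy : ℝ) (g : E)
    (horacle : ∀ x ∈ Q, fy + ⟪g, x - y⟫ ≤ f x)
    (z' : E) (hz'Q : z' ∈ Q)
    (hz'min : ∀ z ∈ Q,
      fy + ⟪g, z' - y⟫ + θ ^ (γ - 1) * L' * V z' zk
        ≤ fy + ⟪g, z - y⟫ + θ ^ (γ - 1) * L' * V z zk)
    (x' : E) (hx' : x' = (1 - θ) • xk + θ • z')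
    (hls : f x' ≤ fy + ⟪g, x' - y⟫ + L' * V x' y + δ) :
    ∀ x ∈ Q,
      (1 / θ ^ γ) * (f x' - f x) + L' * V x z'
        ≤ ((1 - θ) / θ ^ γ) * (f xk - f x) + L' * V x zk + δ / θ ^ γ := by
  intro x hx
  have hθ0 : 0 < θ := hθ.1
  have hpow : 0 < θ ^ γ := Real.rpow_pos_of_pos hθ0 γ
  have hpow_eq : θ * θ ^ (γ - 1) = θ ^ γ := by
    rw [Real.rpow_sub_one hθ0.ne']
    field_simp
  have hprox := bregman_prox_three_point (c := θ ^ (γ - 1) * L') (g := g) (w := zk)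
    hQconv hV (hd z') hz'Q hx fun u hu => by
      have := hz'min u hu
      simp only [inner_sub_right] at this
      linarith
  have hscale : L' * V x' y ≤ L' * (θ ^ γ * V z' zk) := by
    rw [hx', hy]
    exact mul_le_mul_of_nonneg_left
      (hTSP xk hxk z' hz'Q zk hzk θ ⟨hθ0.le, hθ.2⟩) hL'.le
  have hlin : ⟪g, x' - y⟫ = (1 - θ) * ⟪g, xk - y⟫ + θ * ⟪g, z' - y⟫ := by
    rw [hx']
    simp only [inner_sub_right, inner_add_right, inner_smul_right]
    ring
  have hxk_le := mul_le_mul_of_nonneg_left (horacle xk hxk) (sub_nonneg.2 hθ.2)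
  have hx_le := mul_le_mul_of_nonneg_left (horacle x hx) hθ0.le
  have hprox_le := mul_le_mul_of_nonneg_left hprox hθ0.le
  have hstep : f x' - f x + θ ^ γ * (L' * V x z')
      ≤ (1 - θ) * (f xk - f x) + θ ^ γ * (L' * V x zk) + δ := by
    rw [hlin] at hls
    rw [← hpow_eq] at hscale ⊢
    simp only [inner_sub_right] at hls hxk_le hx_le
    linarith
  calc (1 / θ ^ γ) * (f x' - f x) + L' * V x z'
      = (f x' - f x + θ ^ γ * (L' * V x z')) / θ ^ γ := by field_simp
    _ ≤ ((1 - θ) * (f xk - f x) + θ ^ γ * (L' * V x zk) + δ) / θ ^ γ := by gcongr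
    _ = ((1 - θ) / θ ^ γ) * (f xk - f x) + L' * V x zk + δ / θ ^ γ := by field_simp
end

section
/- Let f : Q → ℝ, k ≥ 0, and suppose: (i) points x_0, …, x_k ∈ Q, reals f_0, …, f_k and vectors g_0, …, g_k ∈ E satisfy the oracle lower bound f_i + ⟨g_i, x − x_i⟩ ≤ f(x) for all x ∈ Q and each 0 ≤ i ≤ k; (ii) α_0, …, α_k > 0, A_k := Σ_{i=0}^{k} α_i, B_0, …, B_k ∈ ℝ, δ_0, …, δ_k ≥ 0, and y_k ∈ Q satisfy A_k·f(y_k) − Σ_{i=0}^{k} B_i·δ_i ≤ inf_{x∈Q} Ψ_k(x), where Ψ_k(x) := d(x) + Σ_{i=0}^{k} α_i·(f_i + ⟨g_i, x − x_i⟩). Let x* ∈ Q minimize f over Q. Then f(y_k) − f(x*) ≤ d(x*)/A_k + (1/A_k)·Σ_{i=0}^{k} B_i·δ_i. -/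
open RealInnerProductSpace

/-- Corollary 5.1: from the key estimate `A_k·f(y_k) − Σ B_i·δ_i ≤ inf_{x∈Q} Ψ_k(x)` one
deduces `f(y_k) − f(x*) ≤ d(x*)/A_k + (1/A_k)·Σ_{i=0}^{k} B_i·δ_i`. -/
theorem stmt_11
    {E : Type*} [NormedAddCommGroup E] [InnerProductSpace ℝ E] [CompleteSpace E]
    (Q : Set E) (hQne : Q.Nonempty) (hQclosed : IsClosed Q) (hQconv : Convex ℝ Q)
    (d : E → ℝ) (hd : Differentiable ℝ d) (hdconv : ConvexOn ℝ Set.univ d)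
    (f : E → ℝ) (k : ℕ)
    (xs : ℕ → E) (fs : ℕ → ℝ) (gs : ℕ → E)
    (hmemx : ∀ i ≤ k, xs i ∈ Q)
    (horacle : ∀ i ≤ k, ∀ x ∈ Q, fs i + ⟪gs i, x - xs i⟫ ≤ f x)
    (α B δ : ℕ → ℝ)
    (hαpos : ∀ i ≤ k, 0 < α i) (hδ : ∀ i ≤ k, 0 ≤ δ i)
    (A : ℝ) (hA : A = ∑ i ∈ Finset.range (k + 1), α i)
    (Ψ : E → ℝ)
    (hΨ : ∀ x, Ψ x = d x + ∑ i ∈ Finset.range (k + 1),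
        α i * (fs i + ⟪gs i, x - xs i⟫))
    (yk : E) (hyk : yk ∈ Q)
    (hkey : ∀ x ∈ Q, A * f yk - ∑ i ∈ Finset.range (k + 1), B i * δ i ≤ Ψ x)
    (xstar : E) (hstarQ : xstar ∈ Q) (hstarmin : ∀ x ∈ Q, f xstar ≤ f x) :
    f yk - f xstar ≤ d xstar / A + (1 / A) * ∑ i ∈ Finset.range (k + 1), B i * δ i := by
  have hApos : 0 < A := by
    rw [hA]
    exact Finset.sum_pos (fun i hi => hαpos i (Finset.mem_range_succ_iff.mp hi)) (by simp)
  have hmodel : ∑ i ∈ Finset.range (k + 1), α i * (fs i + ⟪gs i, xstar - xs i⟫)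
      ≤ A * f xstar := by
    rw [hA, Finset.sum_mul]
    refine Finset.sum_le_sum fun i hi => ?_
    have hik := Finset.mem_range_succ_iff.mp hi
    exact mul_le_mul_of_nonneg_left (horacle i hik xstar hstarQ) (hαpos i hik).le
  have hstar := hkey xstar hstarQ
  rw [hΨ] at hstar
  rw [one_div_mul_eq_div, ← add_div, le_div_iff₀ hApos]
  linarith
end

section
/- Let p ∈ [1,2], γ ∈ (1,2], k ≥ 0, and let L_0, …, L_k > 0. Set q := (p−1)(γ−1) and α_i := (1/L_i)·((i+2p)/(2p))^q for 0 ≤ i ≤ k. Then Σ_{i=0}^{k} α_i ≥ (1/ max_{0≤i≤k} L_i) · ((k+2)/4)^{q+1}. -/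
/-- For an exponent `q ≤ 1`, the increment of `x ^ (q + 1)` over a step of length at most `1 / 2`
is at most the value of `x ^ q` at the right endpoint. -/
lemma rpow_add_one_le_rpow_add_one_add_rpow {a b q : ℝ} (ha : 0 < a) (hab : a ≤ b)
    (hba : b ≤ a + 1 / 2) (hq : q ≤ 1) : b ^ (q + 1) ≤ a ^ (q + 1) + b ^ q := by
  have hb : 0 < b := ha.trans_le hab
  have hratio : a / b ≤ (a / b) ^ q := by
    simpa using Real.rpow_le_rpow_of_exponent_ge (div_pos ha hb) ((div_le_one hb).2 hab) hq
  have hB : 0 < b ^ q := Real.rpow_pos_of_pos hb q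
  rw [Real.div_rpow ha.le hb.le, div_le_div_iff₀ hb hB] at hratio
  rw [Real.rpow_add_one hb.ne', Real.rpow_add_one ha.ne']
  have hsq : b ^ 2 - a ^ 2 ≤ b := by nlinarith
  have h₁ := mul_le_mul_of_nonneg_left hratio ha.le
  have h₂ := mul_le_mul_of_nonneg_right hsq hB.le
  refine le_of_mul_le_mul_left ?_ hb
  linarith

lemma rpow_add_one_le_sum_rpow {q : ℝ} (hq0 : 0 ≤ q) (hq1 : q ≤ 1) (k : ℕ) :
    (((k : ℝ) + 2) / 4) ^ (q + 1) ≤ ∑ i ∈ Finset.range (k + 1), (((i : ℝ) + 4) / 4) ^ q := by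
  induction k with
  | zero =>
    have h : ((2 : ℝ) / 4) ^ (q + 1) ≤ 1 :=
      Real.rpow_le_one (by norm_num) (by norm_num) (by linarith)
    simpa using h
  | succ k ih =>
    rw [Finset.sum_range_succ]
    have hk : (0 : ℝ) ≤ k := k.cast_nonneg
    push_cast
    refine (rpow_add_one_le_rpow_add_one_add_rpow (a := ((k : ℝ) + 2) / 4) (by positivity)
      (by linarith) (by linarith) hq1).trans (add_le_add ih ?_)
    exact Real.rpow_le_rpow (by positivity) (by linarith) hq0

/-- Lower bound on `A_k = Σ α_i` in the AIBM method:
`Σ_{i=0}^{k} α_i ≥ (1/max_i L_i) · ((k+2)/4)^{(p−1)(γ−1)+1}`. -/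
theorem stmt_12
    (p γ : ℝ) (hp1 : 1 ≤ p) (hp2 : p ≤ 2) (hγ1 : 1 < γ) (hγ2 : γ ≤ 2)
    (k : ℕ) (L : ℕ → ℝ) (hL : ∀ i ≤ k, 0 < L i) :
    (1 / (Finset.range (k + 1)).sup' (Finset.nonempty_range_iff.mpr k.succ_ne_zero) L)
        * (((k : ℝ) + 2) / 4) ^ ((p - 1) * (γ - 1) + 1)
      ≤ ∑ i ∈ Finset.range (k + 1),
          (1 / L i) * (((i : ℝ) + 2 * p) / (2 * p)) ^ ((p - 1) * (γ - 1)) := by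
  have hq0 : 0 ≤ (p - 1) * (γ - 1) := mul_nonneg (by linarith) (by linarith)
  have hq1 : (p - 1) * (γ - 1) ≤ 1 := mul_le_one₀ (by linarith) (by linarith) (by linarith)
  have hp : 0 < p := by linarith
  have hM : 0 < (Finset.range (k + 1)).sup' (Finset.nonempty_range_iff.mpr k.succ_ne_zero) L :=
    (hL 0 k.zero_le).trans_le (Finset.le_sup' L (by simp))
  refine (mul_le_mul_of_nonneg_left (rpow_add_one_le_sum_rpow hq0 hq1 k)
    (one_div_nonneg.2 hM.le)).trans ?_
  rw [Finset.mul_sum]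
  refine Finset.sum_le_sum fun i hi => ?_
  have hLi : 0 < L i := hL i (Finset.mem_range_succ_iff.1 hi)
  have hi0 : (0 : ℝ) ≤ i := i.cast_nonneg
  have hbase : ((i : ℝ) + 4) / 4 ≤ ((i : ℝ) + 2 * p) / (2 * p) := by
    rw [div_le_div_iff₀ (by norm_num) (by positivity)]
    nlinarith
  exact mul_le_mul (one_div_le_one_div_of_le hLi (Finset.le_sup' L hi))
    (Real.rpow_le_rpow (by positivity) hbase hq0) (by positivity) (by positivity)
end

section
/- (Universality of the accelerated Bregman proximal gradient step.) Let f : Q → ℝ be differentiable with gradient ∇f, let L > 0, δ ≥ 0, γ ∈ (1,2], and suppose f satisfies the relative Lipschitz-type inequality f(x) ≤ f(y) + ⟨∇f(y), x − y⟩ + L·V(x,y) + L·V(y,x) + δ for all x, y ∈ Q, and that V satisfies the triangular scaling property with factor γ. Let L' ≥ L, θ ∈ (0,1], x_k, z_k ∈ Q, set y := (1−θ)·x_k + θ·z_k, let z' ∈ Q minimize z ↦ ⟨∇f(y), z − y⟩ + θ^{γ−1}·L'·V(z, z_k) over Q, and set x' := (1−θ)·x_k + θ·z'. Then f(x') ≤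 f(y) + δ. -/
open RealInnerProductSpace

section

variable {E : Type*} [NormedAddCommGroup E] [InnerProductSpace ℝ E] [CompleteSpace E]

theorem inner_gradient_eq_fderiv (d : E → ℝ) (y v : E) :
    ⟪gradient d y, v⟫ = fderiv ℝ d y v := by
  rw [← toDual_gradient, InnerProductSpace.toDual_apply_apply]

/-- A differentiable convex function lies above its tangent hyperplanes. -/
theorem ConvexOn.inner_gradient_le_sub {d : E → ℝ} (hdconv : ConvexOn ℝ Set.univ d)
    (hd : Differentiable ℝ d) (x y : E) :
    ⟪gradient d y, x - y⟫ ≤ d x - d y := by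
  have hconv : ConvexOn ℝ Set.univ (d ∘ AffineMap.lineMap (k := ℝ) y x) :=
    hdconv.comp_affineMap (AffineMap.lineMap (k := ℝ) y x)
  have hderiv : HasDerivAt (d ∘ AffineMap.lineMap (k := ℝ) y x) (fderiv ℝ d y (x - y)) 0 := by
    refine HasFDerivAt.comp_hasDerivAt 0 ?_ AffineMap.hasDerivAt_lineMap
    simpa using (hd y).hasFDerivAt
  have h := hconv.le_slope_of_hasDerivAt (Set.mem_univ 0) (Set.mem_univ 1) one_pos hderiv
  rw [inner_gradient_eq_fderiv]
  simpa [slope_def_field] using h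

/-- First-order optimality condition for a Bregman proximal step with linear term `g`,
weight `c` and centre `w`. -/
theorem inner_add_gradient_sub_nonneg_of_isMinOn {Q : Set E} (hQ : Convex ℝ Q) {d : E → ℝ}
    (hd : Differentiable ℝ d) {g y w p z : E} {c : ℝ} (hp : p ∈ Q) (hz : z ∈ Q)
    (hmin : IsMinOn
      (fun z ↦ ⟪g, z - y⟫ + c * (d z - d w - ⟪gradient d w, z - w⟫)) Q p) :
    0 ≤ ⟪g, z - p⟫ + c * (⟪gradient d p, z - p⟫ - ⟪gradient d w, z - p⟫) := by
  have hlin (a b : E) : HasFDerivAt (fun z ↦ ⟪a, z - b⟫) (innerSL ℝ a) p :=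
    (innerSL ℝ a).hasFDerivAt.comp p ((hasFDerivAt_id p).sub_const b)
  have hderiv := (hlin g y).add
    ((((hd p).hasFDerivAt.sub_const (d w)).sub (hlin (gradient d w) w)).const_mul c)
  have h := hmin.localize.hasFDerivWithinAt_nonneg hderiv.hasFDerivWithinAt
    (sub_mem_posTangentConeAt_of_segment_subset (hQ.segment_subset hp hz))
  simpa [inner_gradient_eq_fderiv] using h

end

/-- Remark 4.1 (universality of the accelerated Bregman proximal gradient step): for a
relatively Lipschitz continuous function, the accelerated step satisfies `f(x') ≤ f(y) + δ`. -/
theorem stmt_15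
    {E : Type*} [NormedAddCommGroup E] [InnerProductSpace ℝ E] [CompleteSpace E]
    (Q : Set E) (hQne : Q.Nonempty) (hQclosed : IsClosed Q) (hQconv : Convex ℝ Q)
    (d : E → ℝ) (hd : Differentiable ℝ d) (hdconv : ConvexOn ℝ Set.univ d)
    (V : E → E → ℝ)
    (hV : ∀ x y, V x y = d x - d y - ⟪gradient d y, x - y⟫)
    (f : E → ℝ) (hf : Differentiable ℝ f)
    (L δ γ : ℝ) (hL : 0 < L) (hδ : 0 ≤ δ) (hγ1 : 1 < γ) (hγ2 : γ ≤ 2)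
    (hrelLip : ∀ x ∈ Q, ∀ y ∈ Q,
      f x ≤ f y + ⟪gradient f y, x - y⟫ + L * V x y + L * V y x + δ)
    (hTSP : ∀ x ∈ Q, ∀ z ∈ Q, ∀ z' ∈ Q, ∀ θ : ℝ, θ ∈ Set.Icc (0 : ℝ) 1 →
      V ((1 - θ) • x + θ • z) ((1 - θ) • x + θ • z') ≤ θ ^ γ * V z z')
    (L' : ℝ) (hL' : L ≤ L')
    (θ : ℝ) (hθ : θ ∈ Set.Ioc (0 : ℝ) 1)
    (xk zk : E) (hxk : xk ∈ Q) (hzk : zk ∈ Q)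
    (y : E) (hy : y = (1 - θ) • xk + θ • zk)
    (z' : E) (hz'Q : z' ∈ Q)
    (hz'min : ∀ z ∈ Q,
      ⟪gradient f y, z' - y⟫ + θ ^ (γ - 1) * L' * V z' zk
        ≤ ⟪gradient f y, z - y⟫ + θ ^ (γ - 1) * L' * V z zk)
    (x' : E) (hx' : x' = (1 - θ) • xk + θ • z') :
    f x' ≤ f y + δ := by
  obtain ⟨hθ0, hθ1⟩ := hθ
  have hθ' : θ ∈ Set.Icc (0 : ℝ) 1 := ⟨hθ0.le, hθ1⟩
  have hVnonneg (a b : E) : 0 ≤ V a b := by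
    rw [hV]
    exact sub_nonneg.2 (hdconv.inner_gradient_le_sub hd a b)
  have hyQ : y ∈ Q :=
    hy ▸ hQconv hxk hzk (sub_nonneg.2 hθ1) hθ0.le (sub_add_cancel 1 θ)
  have hx'Q : x' ∈ Q :=
    hx' ▸ hQconv hxk hz'Q (sub_nonneg.2 hθ1) hθ0.le (sub_add_cancel 1 θ)
  have hV₁ : V x' y ≤ θ ^ γ * V z' zk := by
    rw [hx', hy]
    exact hTSP xk hxk z' hz'Q zk hzk θ hθ'
  have hV₂ : V y x' ≤ θ ^ γ * V zk z' := by
    rw [hx', hy]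
    exact hTSP xk hxk zk hzk z' hz'Q θ hθ'
  have hstep : ⟪gradient f y, x' - y⟫ = θ * ⟪gradient f y, z' - zk⟫ := by
    rw [hx', hy, add_sub_add_left_eq_sub, ← smul_sub, inner_smul_right]
  have hopt : ⟪gradient f y, z' - zk⟫ + θ ^ (γ - 1) * L' * (V z' zk + V zk z') ≤ 0 := by
    have h := inner_add_gradient_sub_nonneg_of_isMinOn hQconv hd hz'Q hzk
      (g := gradient f y) (y := y) (w := zk) (c := θ ^ (γ - 1) * L')
      (isMinOn_iff.2 fun z hz ↦ by simpa only [hV] using hz'min z hz)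
    rw [hV, hV]
    simp only [← neg_sub z' zk, inner_neg_right] at h ⊢
    linarith
  have hpow : θ * θ ^ (γ - 1) = θ ^ γ := by
    rw [← Real.rpow_one_add' hθ0.le (by linarith), add_sub_cancel]
  have hopt' : θ * ⟪gradient f y, z' - zk⟫ + θ ^ γ * L' * (V z' zk + V zk z') ≤ 0 := by
    rw [← hpow]
    linarith [mul_nonpos_of_nonneg_of_nonpos hθ0.le hopt]
  have hL₁ : L * (V x' y + V y x') ≤ L * (θ ^ γ * (V z' zk + V zk z')) :=
    mul_le_mul_of_nonneg_left (by linarith) hL.le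
  have hL₂ : L * (θ ^ γ * (V z' zk + V zk z')) ≤ L' * (θ ^ γ * (V z' zk + V zk z')) :=
    mul_le_mul_of_nonneg_right hL' <| mul_nonneg (Real.rpow_nonneg hθ0.le γ) <|
      add_nonneg (hVnonneg _ _) (hVnonneg _ _)
  have hf' := hrelLip x' hx'Q y hyQ
  rw [hstep] at hf'
  linarith
end
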